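/- (Linear combination conversion theorem) In the DAE setting, let u ≢ 0 satisfy Jᵀu = 0 with I = {i : u_i ≢ 0}, θ = min_{i∈I} c_i, and L = {i ∈ I : c_i = θ}. Assume the LC condition: for all j, every derivative of x_j occurring in u has order < d_j - θ. If equation f_l (for any l ∈ L) is replaced by f̄ = Σ_{i∈I} u_i f_i^{(c_i-θ)}, then the signature matrix Σ̄ of the resulting system satisfies val(Σ̄) < val(Σ). -/

import Mathlib

open MvPolynomial

/-- Differential polynomials in the formal variables `t` (= `none`) and
`x_j^{(k)}` (= `some (j, k)`), with real coefficients. -/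
abbrev DPoly (n : ℕ) := MvPolynomial (Option (Fin n × ℕ)) ℝ

/-- The formal variable `x_j^{(k)}`. -/
noncomputable def Xv {n : ℕ} (j : Fin n) (k : ℕ) : DPoly n := X (some (j, k))

/-- The total time derivative operator `D`, acting by the chain rule. -/
noncomputable def Dop {n : ℕ} : DPoly n → DPoly n :=
  MvPolynomial.mkDerivation ℝ fun v : Option (Fin n × ℕ) =>
    match v with
    | none => (1 : DPoly n)
    | some (j, k) => Xv j (k + 1)

/-- `hod w j`: the highest order of a derivative of `x_j` occurring in `w`
(`⊥` = `-∞` if `x_j` does not occur). This is the signature entry `σ_{ij}`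
when `w = f i`. -/
noncomputable def hod {n : ℕ} (w : DPoly n) (j : Fin n) : WithBot ℤ :=
  w.vars.sup fun v =>
    match v with
    | some (j', k) => if j' = j then ((k : ℤ) : WithBot ℤ) else ⊥
    | none => ⊥

/-- The System Jacobian: `J i j = ∂f_i/∂x_j^{(d_j - c_i)}` (which is `0`
when `d j - c i > σ_{ij}`), and `0` when `d j - c i < 0`. -/
noncomputable def sysJac {n : ℕ} (f : Fin n → DPoly n) (c d : Fin n → ℕ) :
    Matrix (Fin n) (Fin n) (DPoly n) :=
  fun i j => if c i ≤ d j then pderiv (some (j, d j - c i)) (f i) else 0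

/-- `tval` and `sigVal`: transversal value and value of a signature matrix. -/
def tval {n : ℕ} (A : Matrix (Fin n) (Fin n) (WithBot ℤ)) (p : Equiv.Perm (Fin n)) : WithBot ℤ :=
  ∑ i, A i (p i)

noncomputable def sigVal {n : ℕ} (A : Matrix (Fin n) (Fin n) (WithBot ℤ)) : WithBot ℤ :=
  Finset.univ.sup fun p : Equiv.Perm (Fin n) => tval A p

/-- The signature matrix of a system `f = 0`. -/
noncomputable def sigMat {n : ℕ} (f : Fin n → DPoly n) : Matrix (Fin n) (Fin n) (WithBot ℤ) :=
  fun i j => hod (f i) j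

/-- In characteristic zero, a variable occurs in a polynomial exactly when the corresponding
partial derivative is nonzero. -/
theorem pderiv_eq_zero_iff_notMem_vars {R σ : Type*} [CommRing R] [CharZero R] [IsDomain R]
    {v : σ} {w : MvPolynomial σ R} : pderiv v w = 0 ↔ v ∉ w.vars := by
  classical
  refine ⟨fun h hv => ?_, pderiv_eq_zero_of_notMem_vars⟩
  obtain ⟨m, hm, hmv⟩ := mem_vars_iff_mem_support v |>.1 hv
  have hm0 : m v ≠ 0 := Finsupp.mem_support_iff.1 hmv
  have hle : Finsupp.single v 1 ≤ m := by
    rw [Finsupp.single_le_iff]; omega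
  have h1 := congrArg (coeff (m - Finsupp.single v 1)) h
  rw [coeff_pderiv, tsub_add_cancel_of_le hle, coeff_zero, mul_eq_zero] at h1
  rcases h1 with h1 | h1
  · exact mem_support_iff.1 hm h1
  · exact Nat.cast_add_one_ne_zero _ h1

theorem hod_lt_iff {n : ℕ} {w : DPoly n} {j : Fin n} {a : ℤ} :
    hod w j < (a : WithBot ℤ) ↔ ∀ k : ℕ, a ≤ k → pderiv (some (j, k)) w = 0 := by
  simp only [hod, Finset.sup_lt_iff (WithBot.bot_lt_coe a), pderiv_eq_zero_iff_notMem_vars]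
  constructor
  · intro h k hk hv
    have := h _ hv
    simp only [if_true, WithBot.coe_lt_coe] at this
    omega
  · rintro h (_ | ⟨j', k⟩) hv
    · exact WithBot.bot_lt_coe a
    · by_cases hj : j' = j
      · subst hj
        simp only [if_true, WithBot.coe_lt_coe]
        by_contra hk
        exact h k (by omega) hv
      · simp [hj]

/-- The total time derivative as a derivation. -/
noncomputable def totalDerivation {n : ℕ} : Derivation ℝ (DPoly n) (DPoly n) :=
  MvPolynomial.mkDerivation ℝ fun v : Option (Fin n × ℕ) =>
    match v with
    | none => (1 : DPoly n)
    | some (j, k) => Xv j (k + 1)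

theorem Dop_eq_totalDerivation {n : ℕ} (w : DPoly n) : Dop w = totalDerivation w := rfl

theorem Dop_zero {n : ℕ} : Dop (0 : DPoly n) = 0 := by
  rw [Dop_eq_totalDerivation, map_zero]

/-- The commutator of `∂/∂x_j^{(k+1)}` with the total derivative is `∂/∂x_j^{(k)}`. -/
theorem pderiv_succ_Dop {n : ℕ} (w : DPoly n) (j : Fin n) (k : ℕ) :
    pderiv (some (j, k + 1)) (Dop w)
      = Dop (pderiv (some (j, k + 1)) w) + pderiv (some (j, k)) w := by
  classical
  have h : ⁅(pderiv (some (j, k + 1)) : Derivation ℝ (DPoly n) (DPoly n)), totalDerivation (n := n)⁆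
      = pderiv (some (j, k)) := by
    apply MvPolynomial.derivation_ext
    rintro (_ | ⟨j', k'⟩)
    · simp [totalDerivation, Derivation.commutator_apply, mkDerivation_X, pderiv_X]
    · rw [Derivation.commutator_apply]
      simp only [totalDerivation, mkDerivation_X, pderiv_X, Xv, Pi.single_apply, Option.some.injEq,
        Prod.mk.injEq, Nat.add_right_cancel_iff]
      split_ifs <;> simp
  simp only [Dop_eq_totalDerivation]
  have := DFunLike.congr_fun h w
  rw [Derivation.commutator_apply, sub_eq_iff_eq_add'] at this
  exact this

/-- `∂/∂x_j` commutes with the total derivative. -/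
theorem pderiv_zero_Dop {n : ℕ} (w : DPoly n) (j : Fin n) :
    pderiv (some (j, 0)) (Dop w) = Dop (pderiv (some (j, 0)) w) := by
  classical
  have h : ⁅(pderiv (some (j, 0)) : Derivation ℝ (DPoly n) (DPoly n)), totalDerivation (n := n)⁆
      = (0 : Derivation ℝ (DPoly n) (DPoly n)) := by
    apply MvPolynomial.derivation_ext
    rintro (_ | ⟨j', k'⟩)
    · simp [totalDerivation, Derivation.commutator_apply, mkDerivation_X, pderiv_X]
    · rw [Derivation.commutator_apply]
      simp only [totalDerivation, mkDerivation_X, pderiv_X, Xv, Pi.single_apply, Option.some.injEq,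
        Prod.mk.injEq]
      split_ifs <;> simp_all
  simp only [Dop_eq_totalDerivation]
  have := DFunLike.congr_fun h w
  rw [Derivation.commutator_apply, Derivation.zero_apply, sub_eq_zero] at this
  exact this

/-- Differentiating `m` times raises the order of each variable by at most `m`. -/
theorem hod_iterate_Dop_lt {n : ℕ} {w : DPoly n} {j : Fin n} {a : ℤ}
    (h : hod w j < (a : WithBot ℤ)) (m : ℕ) :
    hod (Dop^[m] w) j < ((a + m : ℤ) : WithBot ℤ) := by
  induction m with
  | zero => simpa using h
  | succ m ih =>
    rw [hod_lt_iff] at ih ⊢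
    rintro (_ | k) hk
    · rw [Function.iterate_succ_apply', pderiv_zero_Dop, ih 0 (by push_cast at hk ⊢; omega),
        Dop_zero]
    · rw [Function.iterate_succ_apply', pderiv_succ_Dop,
        ih (k + 1) (by push_cast at hk ⊢; omega), ih k (by push_cast at hk ⊢; omega),
        Dop_zero, add_zero]

/-- Griewank's lemma: `∂w^{(m)}/∂x_j^{(k+m)} = ∂w/∂x_j^{(k)}` if `x_j` has order at most `k`
in `w`. -/
theorem pderiv_iterate_Dop {n : ℕ} {w : DPoly n} {j : Fin n} {k : ℕ}
    (h : hod w j < ((k + 1 : ℤ) : WithBot ℤ)) (m : ℕ) :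
    pderiv (some (j, k + m)) (Dop^[m] w) = pderiv (some (j, k)) w := by
  induction m with
  | zero => rfl
  | succ m ih =>
    rw [Function.iterate_succ_apply', ← add_assoc, pderiv_succ_Dop, ih,
      hod_lt_iff.1 (hod_iterate_Dop_lt h m) (k + m + 1) (by push_cast; omega), Dop_zero, zero_add]

/-- The combination `∑ u i · f i^{(c i - θ)}` depends on `x_j` only to order `< d j - θ`. -/
theorem hod_linearCombination_lt {n : ℕ} {f u : Fin n → DPoly n} {c d : Fin n → ℕ}
    (hle : ∀ i j, sigMat f i j ≤ (((d j : ℤ) - (c i : ℤ) : ℤ) : WithBot ℤ))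
    (hker : ∀ j, ∑ i, u i * sysJac f c d i j = 0) {θ : ℕ}
    (hθ : ∀ i, u i ≠ 0 → θ ≤ c i)
    (hu : ∀ i j, hod (u i) j < (((d j : ℤ) - (θ : ℤ) : ℤ) : WithBot ℤ)) (j : Fin n) :
    hod (∑ i, u i * Dop^[c i - θ] (f i)) j < (((d j : ℤ) - (θ : ℤ) : ℤ) : WithBot ℤ) := by
  have hf (i) : hod (f i) j < (((d j : ℤ) - c i + 1 : ℤ) : WithBot ℤ) :=
    (hle i j).trans_lt (WithBot.coe_lt_coe.2 (by omega))
  rw [hod_lt_iff]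
  intro k hk
  have hsum : pderiv (some (j, k)) (∑ i, u i * Dop^[c i - θ] (f i))
      = ∑ i, u i * pderiv (some (j, k)) (Dop^[c i - θ] (f i)) := by
    rw [map_sum]
    refine Finset.sum_congr rfl fun i _ => ?_
    rw [Derivation.leibniz, hod_lt_iff.1 (hu i j) k hk, smul_zero, add_zero, smul_eq_mul]
  rw [hsum]
  by_cases hk' : k + θ = d j
  · rw [← hker j]
    refine Finset.sum_congr rfl fun i _ => ?_
    by_cases hi : u i = 0
    · simp [hi]
    have hci := hθ i hi
    congr 1
    unfold sysJac
    split_ifs with hcd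
    · have hkk : k = (d j - c i) + (c i - θ) := by omega
      rw [hkk]
      refine pderiv_iterate_Dop ?_ _
      rw [Nat.cast_sub hcd]
      exact hf i
    · have h0 : hod (f i) j < (((d j : ℤ) - c i : ℤ) : WithBot ℤ) :=
        hod_lt_iff.2 fun m _ => hod_lt_iff.1 (hf i) m (by omega)
      exact hod_lt_iff.1 (hod_iterate_Dop_lt h0 _) k (by omega)
  · refine Finset.sum_eq_zero fun i _ => ?_
    by_cases hi : u i = 0
    · simp [hi]
    have hci := hθ i hi
    rw [hod_lt_iff.1 (hod_iterate_Dop_lt (hf i) _) k (by omega), mul_zero]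

theorem WithBot.sum_lt_coe_sum {ι : Type*} {s : Finset ι} {a : ι → WithBot ℤ} {b : ι → ℤ}
    (hle : ∀ i ∈ s, a i ≤ b i) (hlt : ∃ i ∈ s, a i < b i) :
    ∑ i ∈ s, a i < ((∑ i ∈ s, b i : ℤ) : WithBot ℤ) := by
  by_cases h : ∃ i ∈ s, a i = ⊥
  · rw [WithBot.sum_eq_bot_iff.2 h]
    exact WithBot.bot_lt_coe _
  · push Not at h
    have ha : ∀ i ∈ s, a i = (((a i).unbotD 0 : ℤ) : WithBot ℤ) := fun i hi => by
      obtain ⟨z, hz⟩ := WithBot.ne_bot_iff_exists.1 (h i hi)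
      simp [← hz]
    rw [Finset.sum_congr rfl ha, ← WithBot.coe_sum, WithBot.coe_lt_coe]
    refine Finset.sum_lt_sum (fun i hi => ?_) ?_
    · have := hle i hi
      rw [ha i hi] at this
      exact WithBot.coe_le_coe.1 this
    · obtain ⟨i, hi, hil⟩ := hlt
      rw [ha i hi] at hil
      exact ⟨i, hi, WithBot.coe_lt_coe.1 hil⟩

/-- A signature matrix bounded by `d j - c i`, strictly so in row `l`, has value less than
`∑ d j - ∑ c i`. -/
theorem sigVal_lt {n : ℕ} {A : Matrix (Fin n) (Fin n) (WithBot ℤ)} {c d : Fin n → ℤ}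
    (hle : ∀ i j, A i j ≤ ((d j - c i : ℤ) : WithBot ℤ)) {l : Fin n}
    (hlt : ∀ j, A l j < ((d j - c l : ℤ) : WithBot ℤ)) :
    sigVal A < ((∑ j, d j - ∑ i, c i : ℤ) : WithBot ℤ) := by
  refine (Finset.sup_lt_iff (WithBot.bot_lt_coe _)).2 fun p _ => ?_
  rw [← Equiv.sum_comp p d, ← Finset.sum_sub_distrib]
  exact WithBot.sum_lt_coe_sum (fun i _ => hle i (p i)) ⟨l, Finset.mem_univ l, hlt (p l)⟩

/-- **Linear combination conversion theorem.** With `u ≠ 0` in the cokernel of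
the System Jacobian, `θ = min {c i : u i ≢ 0}`, `l` with `u l ≠ 0` and
`c l = θ`, and the LC condition (every derivative of `x_j` occurring in `u` has
order `< d j - θ`), replacing `f l` by `f̄ = ∑ u i · f i^{(c i - θ)}` strictly
decreases the value of the signature matrix. -/
theorem stmt6 {n : ℕ} (f u : Fin n → DPoly n) (c d : Fin n → ℕ)
    (hle : ∀ i j, sigMat f i j ≤ (((d j : ℤ) - (c i : ℤ) : ℤ) : WithBot ℤ))
    (T : Equiv.Perm (Fin n))
    (hT : ∀ i, sigMat f i (T i) = (((d (T i) : ℤ) - (c i : ℤ) : ℤ) : WithBot ℤ))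
    (hu0 : u ≠ 0)
    (hker : ∀ j, ∑ i, u i * sysJac f c d i j = 0)
    (θ : ℕ)
    (hθ1 : ∀ i, u i ≠ 0 → θ ≤ c i)
    (hθ2 : ∃ i, u i ≠ 0 ∧ c i = θ)
    (hu : ∀ i j, hod (u i) j < (((d j : ℤ) - (θ : ℤ) : ℤ) : WithBot ℤ))
    (l : Fin n) (hul : u l ≠ 0) (hcl : c l = θ) :
    sigVal (sigMat (Function.update f l (∑ i, u i * Dop^[c i - θ] (f i))))
      < sigVal (sigMat f) := by
  have hrow := hod_linearCombination_lt hle hker hθ1 hu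
  have hlt (j) : sigMat (Function.update f l (∑ i, u i * Dop^[c i - θ] (f i))) l j
      < (((d j : ℤ) - (c l : ℤ) : ℤ) : WithBot ℤ) := by
    simpa [sigMat, hcl] using hrow j
  have hval := sigVal_lt (c := fun i => (c i : ℤ)) (d := fun j => (d j : ℤ)) (fun i j => by
    by_cases hi : i = l
    · subst hi
      exact (hlt j).le
    · simpa [sigMat, Function.update_of_ne hi] using hle i j) hlt
  refine hval.trans_le ?_
  have hTval : tval (sigMat f) T = ((∑ j, (d j : ℤ) - ∑ i, (c i : ℤ) : ℤ) : WithBot ℤ) := by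
    rw [← Equiv.sum_comp T (fun j => (d j : ℤ)), ← Finset.sum_sub_distrib, WithBot.coe_sum]
    exact Finset.sum_congr rfl fun i _ => hT i
  rw [← hTval]
  exact Finset.le_sup (f := fun p => tval (sigMat f) p) (Finset.mem_univ T)
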